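/- arXiv:2208.05936 — 2 statements merged into one kernel-verified Lean document; each statement's English description precedes it below -/
import Mathlib

section
/- Theorem 3.2(b) (aliasing expansion of the direct reconstruction): Let f be a Schwartz function on ℝ², ψ ∈ C^∞(S¹) even, m ≥ 1 an integer, and f_{ψ,δ} the discrete filtered backprojection. Then for every x ∈ ℝ², f_{ψ,δ}(x) = Σ_{k∈ℤ} (1/(4π²)) ∫_{ℝ²} e^{i x·ξ} ψ(ξ/|ξ|) e^{−2 i m k·arg(ξ)} 𝓕f(ξ) dξ, the series converging absolutely; equivalently, f_{ψ,δ}(x) = f_ψ(x) + Σ_{k=1}^∞ (1/(2π²)) ∫_{ℝ²} e^{i x·ξ} ψ(ξ/|ξ|) cos(2 m k·arg(ξ)) 𝓕f(ξ) dξ, where f_ψ(x) = (1/(4π²)) ∫_{ℝ²} e^{i x·ξ} ψ(ξ/|ξ|) 𝓕f(ξ) dξ. -/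
open MeasureTheory Real intervalIntegral
open scoped RealInnerProductSpace

noncomputable section

/-- The plane `ℝ²` as a Euclidean space. -/
abbrev E2 : Type := EuclideanSpace ℝ (Fin 2)

/-- The unit vector `ω(φ) = (cos φ, sin φ)`. -/
def omega (φ : ℝ) : E2 := (WithLp.equiv 2 (Fin 2 → ℝ)).symm ![Real.cos φ, Real.sin φ]

/-- Identify `ξ ∈ ℝ²` with the complex number `ξ₁ + i ξ₂`; its argument is the
polar angle of `ξ`.  For `n ∈ ℤ`, `e^{i n·arg ξ}` and `cos(n·arg ξ)` do not
depend on the branch of the argument. -/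
def toC (ξ : E2) : ℂ := (ξ 0 : ℂ) + (ξ 1 : ℂ) * Complex.I

/-- The Fourier transform on `ℝ²`: `𝓕f(ξ) = ∫ e^{−i x·ξ} f(x) dx`. -/
def FT (f : E2 → ℂ) (ξ : E2) : ℂ :=
  ∫ x : E2, Complex.exp (-(Complex.I * (⟪x, ξ⟫ : ℂ))) * f x

/-- The filtered projection `G_f(ω,p) = (1/(8π²)) ∫ e^{i p q} |q| 𝓕f(qω) dq`,
which equals `ℋℛf` by the Fourier slice theorem. -/
def filtProj (f : E2 → ℂ) (w : E2) (p : ℝ) : ℂ :=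
  (1 / (8 * (π : ℂ) ^ 2)) * ∫ q : ℝ, Complex.exp (Complex.I * p * q) * (|q| : ℝ) * FT f (q • w)

/-- The discrete filtered backprojection with angular step `π/m`:
`f_{ψ,δ}(x) = (2π/m) Σ_{j=1}^{m} ψ(ω_j) G_f(ω_j, x·ω_j)`, `ω_j = ω(π j/m)`. -/
def discreteFBP (f : E2 → ℂ) (ψ : E2 → ℂ) (m : ℕ) (x : E2) : ℂ :=
  (2 * (π : ℂ) / (m : ℂ)) * ∑ j ∈ Finset.Icc 1 m,
    ψ (omega (π * (j : ℝ) / (m : ℝ))) *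
      filtProj f (omega (π * (j : ℝ) / (m : ℝ))) ⟪x, omega (π * (j : ℝ) / (m : ℝ))⟫

/-- The `k`-th aliased component
`(1/(4π²)) ∫ e^{i x·ξ} ψ(ξ/|ξ|) e^{−2imk·arg ξ} 𝓕f(ξ) dξ`. -/
def aliasTerm (f : E2 → ℂ) (ψ : E2 → ℂ) (m : ℕ) (k : ℤ) (x : E2) : ℂ :=
  (1 / (4 * (π : ℂ) ^ 2)) *
    ∫ ξ : E2, Complex.exp (Complex.I * (⟪x, ξ⟫ : ℂ)) * ψ (‖ξ‖⁻¹ • ξ) *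
      Complex.exp (-(2 * Complex.I * (m : ℂ) * (k : ℂ) * ((toC ξ).arg : ℂ))) * FT f ξ

/-- The `k`-th cosine artifact term
`(1/(2π²)) ∫ e^{i x·ξ} ψ(ξ/|ξ|) cos(2mk·arg ξ) 𝓕f(ξ) dξ`. -/
def cosTerm (f : E2 → ℂ) (ψ : E2 → ℂ) (m : ℕ) (k : ℕ) (x : E2) : ℂ :=
  (1 / (2 * (π : ℂ) ^ 2)) *
    ∫ ξ : E2, Complex.exp (Complex.I * (⟪x, ξ⟫ : ℂ)) * ψ (‖ξ‖⁻¹ • ξ) *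
      (Real.cos (2 * (m : ℝ) * (k : ℝ) * (toC ξ).arg) : ℂ) * FT f ξ

/-- The Fourier coefficients of a function of period `T`, without the normalizing factor `1 / T`. -/
def circleCoeff (T : ℝ) (g : ℝ → ℂ) (n : ℤ) : ℂ :=
  ∫ y in (0 : ℝ)..T, Complex.exp (-(2 * π * Complex.I * n * y / T)) * g y

lemma circleCoeff_eq_deriv {T : ℝ} (hT : 0 < T) {g g' : ℝ → ℂ} (hg : ∀ y, HasDerivAt g (g' y) y)
    (hg' : Continuous g') (hper : Function.Periodic g T) {n : ℤ} (hn : n ≠ 0) :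
    circleCoeff T g n = T / (2 * π * Complex.I * n) * circleCoeff T g' n := by
  have hT' : (T : ℂ) ≠ 0 := by exact_mod_cast hT.ne'
  have hpi : (π : ℂ) ≠ 0 := by exact_mod_cast Real.pi_ne_zero
  have hn' : (n : ℂ) ≠ 0 := by exact_mod_cast hn
  set a : ℂ := -(2 * π * Complex.I * n / T) with ha
  have ha0 : a ≠ 0 := by
    simp [ha, hT', hpi, hn']
  have hE : ∀ y : ℝ, HasDerivAt (fun y : ℝ => Complex.exp (a * y) / a) (Complex.exp (a * y)) y := by
    intro y
    have h1 : HasDerivAt (fun y : ℝ => a * (y : ℂ)) a y := by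
      simpa using (Complex.ofRealCLM.hasDerivAt (x := y)).const_mul a
    simpa only [mul_div_cancel_right₀ _ ha0] using h1.cexp.div_const a
  have key := integral_mul_deriv_eq_deriv_mul (a := 0) (b := T)
    (fun y _ => hg y) (fun y _ => hE y) (hg'.intervalIntegrable _ _)
    ((by fun_prop : Continuous fun y : ℝ => Complex.exp (a * y)).intervalIntegrable _ _)
  have hexp : Complex.exp (a * T) = 1 := by
    rw [Complex.exp_eq_one_iff]
    exact ⟨-n, by rw [ha]; push_cast; field_simp⟩
  have hgT : g T = g 0 := by simpa using hper 0
  have hrw : ∀ (h : ℝ → ℂ), circleCoeff T h n = ∫ y in (0 : ℝ)..T, h y * Complex.exp (a * y) := by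
    intro h
    unfold circleCoeff
    congr 1
    ext y
    rw [mul_comm, ha]
    congr 2
    ring
  rw [hrw g, key, hrw g', hexp, hgT]
  simp only [Complex.ofReal_zero, mul_zero, Complex.exp_zero, sub_self, zero_sub, mul_div_assoc']
  rw [intervalIntegral.integral_div, ha]
  field_simp

lemma norm_circleCoeff_le {T : ℝ} (hT : 0 < T) (g : ℝ → ℂ) (n : ℤ) :
    ‖circleCoeff T g n‖ ≤ ∫ y in (0 : ℝ)..T, ‖g y‖ := by
  refine (intervalIntegral.norm_integral_le_integral_norm hT.le).trans (le_of_eq ?_)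
  congr 1
  ext y
  have : -(2 * π * Complex.I * n * y / T) = ((-(2 * π * n * y / T) : ℝ) : ℂ) * Complex.I := by
    push_cast; ring
  rw [norm_mul, this, Complex.norm_exp_ofReal_mul_I, one_mul]

lemma Function.Periodic.deriv_periodic {g : ℝ → ℂ} {T : ℝ} (h : Function.Periodic g T) :
    Function.Periodic (deriv g) T := by
  intro y
  rw [← deriv_comp_add_const, h.funext]

lemma summable_circleCoeff {T : ℝ} (hT : 0 < T) {g : ℝ → ℂ} (hg : ContDiff ℝ 2 g)
    (hper : Function.Periodic g T) : Summable (circleCoeff T g) := by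
  have h1 : ContDiff ℝ 1 (deriv g) :=
    ((contDiff_succ_iff_deriv (n := 1)).1 (by simpa [one_add_one_eq_two] using hg)).2.2
  have h2 : Continuous (deriv (deriv g)) := h1.continuous_deriv le_rfl
  set C := ∫ y in (0 : ℝ)..T, ‖deriv (deriv g) y‖
  refine Summable.of_norm_bounded_eventually
    (g := fun n : ℤ => (T / (2 * π)) ^ 2 * C * (1 / (n : ℝ) ^ 2))
    ((Real.summable_one_div_int_pow.2 one_lt_two).mul_left _) ?_
  filter_upwards [(Set.finite_singleton (0 : ℤ)).compl_mem_cofinite] with n hn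
  have hn : n ≠ 0 := by simpa using hn
  rw [circleCoeff_eq_deriv hT (fun y => (hg.differentiable two_ne_zero y).hasDerivAt)
      h1.continuous hper hn,
    circleCoeff_eq_deriv hT (fun y => (h1.differentiable one_ne_zero y).hasDerivAt)
      h2 hper.deriv_periodic hn]
  have hb := norm_circleCoeff_le hT (deriv (deriv g)) n
  have hne : |(n : ℝ)| ≠ 0 := by simpa using hn
  simp only [norm_mul, norm_div, Complex.norm_real, Complex.norm_I, Real.norm_eq_abs,
    Complex.norm_intCast, abs_of_pos hT, abs_of_pos Real.pi_pos, Complex.norm_ofNat]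
  calc _ = (T / (2 * π)) ^ 2 * ‖circleCoeff T (deriv (deriv g)) n‖ * (1 / (n : ℝ) ^ 2) := by
        rw [← sq_abs (n : ℝ)]; field_simp
    _ ≤ _ := by gcongr

lemma hasSum_circleCoeff {T : ℝ} (hT : 0 < T) {g : ℝ → ℂ} (hg : ContDiff ℝ 2 g)
    (hper : Function.Periodic g T) (x : ℝ) :
    HasSum (fun n : ℤ => (1 / T : ℂ) * circleCoeff T g n *
      Complex.exp (2 * π * Complex.I * n * x / T)) (g x) := by
  have : Fact (0 < T) := ⟨hT⟩
  let G : C(AddCircle T, ℂ) := ⟨hper.lift, continuous_coinduced_dom.mpr hg.continuous⟩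
  have hG : ∀ y : ℝ, G (y : AddCircle T) = g y := fun y => hper.lift_coe y
  have hc : ∀ n, fourierCoeff G n = (1 / T : ℂ) * circleCoeff T g n := by
    intro n
    rw [fourierCoeff_eq_intervalIntegral _ n 0, zero_add, circleCoeff]
    simp only [hG, fourier_coe_apply, smul_eq_mul, Complex.real_smul]
    push_cast
    congr 3
    ext y
    congr 2
    ring
  have hs : Summable (fourierCoeff G) := by
    rw [funext hc]
    exact (summable_circleCoeff hT hg hper).mul_left _
  have := has_pointwise_sum_fourier_series_of_summable hs (x : AddCircle T)
  simpa only [hc, hG, fourier_coe_apply, smul_eq_mul] using this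

lemma sum_exp_eq_ite {m : ℕ} (hm : 1 ≤ m) (n : ℤ) :
    ∑ j ∈ Finset.Icc 1 m, Complex.exp (2 * π * Complex.I * n * j / m)
      = if (m : ℤ) ∣ n then (m : ℂ) else 0 := by
  have hm' : (m : ℂ) ≠ 0 := by exact_mod_cast (by omega : m ≠ 0)
  set z := Complex.exp (2 * π * Complex.I * n / m) with hz
  have hpow : ∀ j : ℕ, Complex.exp (2 * π * Complex.I * n * j / m) = z ^ j := by
    intro j
    rw [hz, ← Complex.exp_nat_mul]
    congr 1
    ring
  have hz1 : z = 1 ↔ (m : ℤ) ∣ n := by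
    rw [hz, Complex.exp_eq_one_iff]
    refine exists_congr fun k => ?_
    rw [div_eq_iff hm', show (k : ℂ) * (2 * π * Complex.I) * m = 2 * π * Complex.I * (m * k) by ring,
      mul_right_inj' Complex.two_pi_I_ne_zero]
    exact_mod_cast Iff.rfl
  have hzm : z ^ m = 1 := by
    rw [← hpow, Complex.exp_eq_one_iff]
    exact ⟨n, by field_simp⟩
  simp only [hpow]
  split_ifs with h
  · simp [hz1.2 h]
  · have hne : z - 1 ≠ 0 := sub_ne_zero.2 fun h' => h (hz1.1 h')
    have hg : ∑ j ∈ Finset.range m, z ^ j = 0 := by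
      have := mul_geom_sum z m
      rw [hzm, sub_self] at this
      exact (mul_eq_zero.1 this).resolve_left hne
    rw [← Finset.Ico_add_one_right_eq_Icc, Finset.sum_Ico_eq_sum_range]
    simp only [add_tsub_cancel_right, pow_add, ← Finset.mul_sum, hg, mul_zero]

/-- Aliasing for the trapezoidal rule: sampling a periodic function at `m` equidistant nodes
collects the Fourier coefficients whose index is a multiple of `m`. -/
lemma hasSum_circleCoeff_sample {T : ℝ} (hT : 0 < T) {g : ℝ → ℂ} (hg : ContDiff ℝ 2 g)
    (hper : Function.Periodic g T) {m : ℕ} (hm : 1 ≤ m) :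
    HasSum (fun k : ℤ => (1 / T : ℂ) * circleCoeff T g (m * k))
      ((1 / m : ℂ) * ∑ j ∈ Finset.Icc 1 m, g (T * j / m)) := by
  have hm' : (m : ℂ) ≠ 0 := by exact_mod_cast (by omega : m ≠ 0)
  have hT' : (T : ℂ) ≠ 0 := by exact_mod_cast hT.ne'
  have h := (hasSum_sum (s := Finset.Icc 1 m) fun (j : ℕ) _ =>
    hasSum_circleCoeff hT hg hper (T * j / m)).mul_left (1 / m : ℂ)
  have h2 : ∀ n : ℤ, (1 / m : ℂ) * ∑ j ∈ Finset.Icc 1 m, (1 / T : ℂ) * circleCoeff T g n *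
      Complex.exp (2 * π * Complex.I * n * (T * j / m : ℝ) / T)
      = if (m : ℤ) ∣ n then (1 / T : ℂ) * circleCoeff T g n else 0 := by
    intro n
    have : ∀ j : ℕ, (2 * π * Complex.I * n * (T * j / m : ℝ) / T : ℂ)
        = 2 * π * Complex.I * n * j / m := by
      intro j; push_cast; field_simp
    simp only [this, ← Finset.mul_sum, sum_exp_eq_ite hm n]
    split_ifs
    · field_simp
    · simp
  simp only [h2] at h
  have hinj : Function.Injective fun k : ℤ => (m : ℤ) * k :=
    mul_right_injective₀ (by exact_mod_cast (by omega : m ≠ 0))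
  rw [← hinj.hasSum_iff] at h
  · simpa [Function.comp_def] using h
  · intro n hn
    rw [if_neg]
    rintro ⟨k, rfl⟩
    exact hn ⟨k, rfl⟩

lemma omega_apply_zero (φ : ℝ) : omega φ 0 = Real.cos φ := rfl

lemma omega_apply_one (φ : ℝ) : omega φ 1 = Real.sin φ := rfl

lemma omega_eq_smul_add_smul (φ : ℝ) :
    omega φ = Real.cos φ • EuclideanSpace.single 0 1 + Real.sin φ • EuclideanSpace.single 1 1 := by
  ext i
  fin_cases i <;> simp [omega]

@[simp] lemma norm_omega (φ : ℝ) : ‖omega φ‖ = 1 := by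
  simp [EuclideanSpace.norm_eq, Fin.sum_univ_two, omega_apply_zero, omega_apply_one]

lemma omega_ne_zero (φ : ℝ) : omega φ ≠ 0 := by
  rw [← norm_ne_zero_iff, norm_omega]
  exact one_ne_zero

lemma omega_add_pi (φ : ℝ) : omega (φ + π) = -omega φ := by
  simp only [omega_eq_smul_add_smul, Real.cos_add_pi, Real.sin_add_pi]
  module

lemma contDiff_omega {n : WithTop ℕ∞} : ContDiff ℝ n omega := by
  simp only [funext omega_eq_smul_add_smul]
  fun_prop

lemma hasDerivAt_omega (φ : ℝ) :
    HasDerivAt omega ((-Real.sin φ) • EuclideanSpace.single 0 1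
      + Real.cos φ • EuclideanSpace.single 1 1) φ := by
  rw [funext omega_eq_smul_add_smul]
  exact ((Real.hasDerivAt_cos φ).smul_const _).add ((Real.hasDerivAt_sin φ).smul_const _)

lemma continuous_omega : Continuous omega := (contDiff_omega (n := 0)).continuous

lemma SchwartzMap.exists_radial_bound (A : SchwartzMap E2 ℂ) (n : ℕ) :
    ∃ C : ℝ, 0 ≤ C ∧ ∀ φ q : ℝ,
      ‖((|q| * q ^ n : ℝ) : ℂ) * A (q • omega φ)‖ ≤ C * (1 + q ^ 2)⁻¹ := by
  obtain ⟨C₁, hC₁⟩ := A.decay (n + 1) 0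
  obtain ⟨C₂, hC₂⟩ := A.decay (n + 3) 0
  have hbound : ∀ φ q : ℝ,
      ‖((|q| * q ^ n : ℝ) : ℂ) * A (q • omega φ)‖ ≤ (C₁ + C₂) * (1 + q ^ 2)⁻¹ := by
    intro φ q
    have h₁ := hC₁.2 (q • omega φ)
    have h₂ := hC₂.2 (q • omega φ)
    simp only [norm_iteratedFDeriv_zero, norm_smul, norm_omega, mul_one, Real.norm_eq_abs]
      at h₁ h₂
    rw [← div_eq_mul_inv, le_div_iff₀ (by positivity), norm_mul, Complex.norm_real, norm_mul,
      norm_pow, Real.norm_eq_abs, Real.norm_eq_abs, abs_abs, ← sq_abs q]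
    refine le_trans (le_of_eq ?_) (add_le_add h₁ h₂)
    ring
  exact ⟨_, by simpa using (norm_nonneg _).trans (hbound 0 0), hbound⟩

/-- The moment `∫ |q| qⁿ A(q ω(φ)) dq` of `A` along the line through the origin of direction
`ω(φ)`. -/
def radialMoment (A : SchwartzMap E2 ℂ) (n : ℕ) (φ : ℝ) : ℂ :=
  ∫ q : ℝ, ((|q| * q ^ n : ℝ) : ℂ) * A (q • omega φ)

lemma integrable_radialMoment (A : SchwartzMap E2 ℂ) (n : ℕ) (φ : ℝ) :
    Integrable fun q : ℝ => ((|q| * q ^ n : ℝ) : ℂ) * A (q • omega φ) := by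
  obtain ⟨C, -, hC⟩ := A.exists_radial_bound n
  have hcont := A.continuous
  refine (integrable_inv_one_add_sq.const_mul C).mono'
    (Continuous.aestronglyMeasurable (by fun_prop)) (.of_forall (hC φ))

open scoped LineDeriv in
lemma hasDerivAt_radialMoment (A : SchwartzMap E2 ℂ) (n : ℕ) (φ : ℝ) :
    HasDerivAt (radialMoment A n)
      ((-Real.sin φ : ℝ) * radialMoment (∂_{(EuclideanSpace.single 0 1 : E2)} A) (n + 1) φ
        + (Real.cos φ : ℝ) * radialMoment (∂_{(EuclideanSpace.single 1 1 : E2)} A) (n + 1) φ) φ := by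
  set A₀ := ∂_{(EuclideanSpace.single 0 1 : E2)} A with hA₀
  set A₁ := ∂_{(EuclideanSpace.single 1 1 : E2)} A with hA₁
  obtain ⟨C₀, -, hb₀⟩ := A₀.exists_radial_bound (n + 1)
  obtain ⟨C₁, -, hb₁⟩ := A₁.exists_radial_bound (n + 1)
  have hcont := A.continuous
  have key := (hasDerivAt_integral_of_dominated_loc_of_deriv_le (μ := volume) (𝕜 := ℝ) (x₀ := φ)
    (F := fun φ q => ((|q| * q ^ n : ℝ) : ℂ) * A (q • omega φ))
    (F' := fun φ q => ((-Real.sin φ : ℝ) : ℂ) * (((|q| * q ^ (n + 1) : ℝ) : ℂ) * A₀ (q • omega φ))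
      + ((Real.cos φ : ℝ) : ℂ) * (((|q| * q ^ (n + 1) : ℝ) : ℂ) * A₁ (q • omega φ)))
    (bound := fun q => C₀ * (1 + q ^ 2)⁻¹ + C₁ * (1 + q ^ 2)⁻¹)
    Filter.univ_mem
    (.of_forall fun φ => (integrable_radialMoment A n φ).aestronglyMeasurable)
    (integrable_radialMoment A n φ)
    (((integrable_radialMoment A₀ (n + 1) φ).const_mul _).add
      ((integrable_radialMoment A₁ (n + 1) φ).const_mul _)).aestronglyMeasurable
    (.of_forall fun q φ _ => ?_)
    ((integrable_inv_one_add_sq.const_mul C₀).add (integrable_inv_one_add_sq.const_mul C₁))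
    (.of_forall fun q φ _ => ?_)).2
  · rwa [integral_add ((integrable_radialMoment A₀ (n + 1) φ).const_mul _)
      ((integrable_radialMoment A₁ (n + 1) φ).const_mul _), MeasureTheory.integral_const_mul,
      MeasureTheory.integral_const_mul] at key
  · refine (norm_add_le _ _).trans (add_le_add ?_ ?_)
    · rw [norm_mul, Complex.norm_real, norm_neg, Real.norm_eq_abs]
      exact (mul_le_of_le_one_left (norm_nonneg _) (Real.abs_sin_le_one φ)).trans (hb₀ φ q)
    · rw [norm_mul, Complex.norm_real, Real.norm_eq_abs]
      exact (mul_le_of_le_one_left (norm_nonneg _) (Real.abs_cos_le_one φ)).trans (hb₁ φ q)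
  · have h := ((A.hasFDerivAt (q • omega φ)).comp_hasDerivAt φ
      ((hasDerivAt_omega φ).const_smul q)).const_mul ((|q| * q ^ n : ℝ) : ℂ)
    refine h.congr_deriv ?_
    rw [hA₀, hA₁, SchwartzMap.lineDerivOp_apply_eq_fderiv, SchwartzMap.lineDerivOp_apply_eq_fderiv]
    simp only [map_smul, map_add, Complex.real_smul]
    push_cast
    ring

lemma contDiff_radialMoment_nat (k : ℕ) (A : SchwartzMap E2 ℂ) (n : ℕ) :
    ContDiff ℝ k (radialMoment A n) := by
  induction k generalizing A n with
  | zero =>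
    exact contDiff_zero.2 (continuous_iff_continuousAt.2 fun φ =>
      (hasDerivAt_radialMoment A n φ).continuousAt)
  | succ k ih =>
    push_cast
    refine contDiff_succ_iff_deriv.2
      ⟨fun φ => (hasDerivAt_radialMoment A n φ).differentiableAt, by simp, ?_⟩
    rw [funext fun φ => (hasDerivAt_radialMoment A n φ).deriv]
    have hof : ContDiff ℝ k ((↑) : ℝ → ℂ) := Complex.ofRealCLM.contDiff
    exact ((hof.comp Real.contDiff_sin.neg).mul (ih _ _)).add
      ((hof.comp Real.contDiff_cos).mul (ih _ _))

lemma radialMoment_periodic (A : SchwartzMap E2 ℂ) :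
    Function.Periodic (radialMoment A 0) π := by
  intro φ
  unfold radialMoment
  rw [← integral_neg_eq_self]
  simp [omega_add_pi]

/-- The part of `radialMoment A 0 φ` coming from the half-line in direction `ω(φ)`. -/
def halfRadialMoment (A : SchwartzMap E2 ℂ) (φ : ℝ) : ℂ :=
  ∫ q in Set.Ioi (0 : ℝ), (q : ℂ) * A (q • omega φ)

lemma radialMoment_zero_eq (A : SchwartzMap E2 ℂ) (φ : ℝ) :
    radialMoment A 0 φ = halfRadialMoment A φ + halfRadialMoment A (φ + π) := by
  have hi := integrable_radialMoment A 0 φ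
  have hneg := integral_comp_neg_Iic (0 : ℝ) fun q : ℝ => (q : ℂ) * A (q • omega (φ + π))
  rw [neg_zero] at hneg
  rw [radialMoment, ← intervalIntegral.integral_Iic_add_Ioi hi.integrableOn hi.integrableOn (b := 0),
    halfRadialMoment, halfRadialMoment, ← hneg, add_comm]
  congr 1
  · refine setIntegral_congr_fun measurableSet_Ioi fun q hq => ?_
    simp [abs_of_pos (Set.mem_Ioi.1 hq)]
  · refine setIntegral_congr_fun measurableSet_Iic fun q hq => ?_
    simp [abs_of_nonpos (Set.mem_Iic.1 hq), omega_add_pi]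

lemma SchwartzMap.exists_halfRadial_bound (A : SchwartzMap E2 ℂ) :
    ∃ C : ℝ, 0 ≤ C ∧ ∀ φ q : ℝ, ‖(q : ℂ) * A (q • omega φ)‖ ≤ C * (1 + q ^ 2)⁻¹ := by
  simpa using A.exists_radial_bound 0

lemma continuous_halfRadialMoment (A : SchwartzMap E2 ℂ) : Continuous (halfRadialMoment A) := by
  obtain ⟨C, -, hC⟩ := A.exists_halfRadial_bound
  have hcont := A.continuous
  have homega := continuous_omega
  exact continuous_of_dominated
    (fun φ => Continuous.aestronglyMeasurable (by fun_prop))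
    (fun φ => .of_forall (hC φ)) (integrable_inv_one_add_sq.const_mul C).integrableOn
    (.of_forall fun q => by fun_prop)

lemma halfRadialMoment_periodic (A : SchwartzMap E2 ℂ) :
    Function.Periodic (halfRadialMoment A) (2 * π) := by
  intro φ
  simp only [halfRadialMoment, two_mul, ← add_assoc, omega_add_pi, neg_neg]

lemma toC_smul_omega (r θ : ℝ) :
    toC (r • omega θ) = r * (Complex.cos θ + Complex.sin θ * Complex.I) := by
  simp only [toC, PiLp.smul_apply, omega_apply_zero, omega_apply_one, smul_eq_mul]
  push_cast
  ring

lemma toC_eq_repr_symm (ξ : E2) : toC ξ = Complex.orthonormalBasisOneI.repr.symm ξ :=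
  (Complex.orthonormalBasisOneI_repr_symm_apply ξ).symm

lemma integral_eq_polar (F : E2 → ℂ) :
    ∫ ξ, F ξ = ∫ p in Set.Ioi (0 : ℝ) ×ˢ Set.Ioo (-π) π, (p.1 : ℂ) * F (p.1 • omega p.2) := by
  rw [← (Complex.orthonormalBasisOneI.repr.measurePreserving).integral_comp
      Complex.orthonormalBasisOneI.repr.toHomeomorph.measurableEmbedding,
    ← Complex.integral_comp_polarCoord_symm, polarCoord_target]
  congr 1
  ext p
  have : Complex.orthonormalBasisOneI.repr (Complex.polarCoord.symm p) = p.1 • omega p.2 := by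
    apply Complex.orthonormalBasisOneI.repr.symm.injective
    rw [LinearIsometryEquiv.symm_apply_apply, ← toC_eq_repr_symm, toC_smul_omega]
    simp
  rw [this, Complex.real_smul]

lemma integral_arg_mul_eq {γ : ℝ → ℂ} (hγ : Continuous γ) (hper : Function.Periodic γ π)
    (A : SchwartzMap E2 ℂ) :
    ∫ ξ, γ (toC ξ).arg * A ξ = ∫ θ in (0 : ℝ)..π, γ θ * radialMoment A 0 θ := by
  obtain ⟨C, hC, hb⟩ := A.exists_halfRadial_bound
  obtain ⟨M, hM⟩ := (isCompact_Icc (a := -π) (b := π)).exists_bound_of_continuousOn hγ.continuousOn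
  have hcont := A.continuous
  have homega := continuous_omega
  have hhalf := continuous_halfRadialMoment A
  have hint : IntegrableOn (fun p : ℝ × ℝ => γ p.2 * (p.1 * A (p.1 • omega p.2)))
      (Set.Ioi (0 : ℝ) ×ˢ Set.Ioo (-π) π) := by
    have hdom : Integrable (fun p : ℝ × ℝ => C * (1 + p.1 ^ 2)⁻¹ * M)
        ((volume.restrict (Set.Ioi (0 : ℝ))).prod (volume.restrict (Set.Ioo (-π) π))) :=
      (integrable_inv_one_add_sq.const_mul C).integrableOn.mul_prod (integrable_const M)
    rw [Measure.prod_restrict] at hdom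
    refine hdom.mono' (Continuous.aestronglyMeasurable (by fun_prop)) ?_
    filter_upwards [ae_restrict_mem (measurableSet_Ioi.prod measurableSet_Ioo)] with p hp
    rw [norm_mul, mul_comm]
    exact mul_le_mul (hb _ _) (hM _ (Set.Ioo_subset_Icc_self hp.2)) (norm_nonneg _)
      (by positivity)
  have hshift : ∫ θ in (-π)..0, γ θ * halfRadialMoment A θ
      = ∫ θ in (0 : ℝ)..π, γ θ * halfRadialMoment A (θ + π) := by
    rw [← zero_sub π, ← sub_self π, ← intervalIntegral.integral_comp_sub_right, sub_self]
    congr 1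
    ext θ
    rw [hper.sub_eq, ← halfRadialMoment_periodic A (θ - π)]
    congr 2
    ring
  calc ∫ ξ, γ (toC ξ).arg * A ξ
      = ∫ p in Set.Ioi (0 : ℝ) ×ˢ Set.Ioo (-π) π, γ p.2 * (p.1 * A (p.1 • omega p.2)) := by
        rw [integral_eq_polar]
        refine setIntegral_congr_fun (measurableSet_Ioi.prod measurableSet_Ioo) fun p hp => ?_
        simp only [toC_smul_omega]
        rw [Complex.arg_mul_cos_add_sin_mul_I hp.1 (Set.Ioo_subset_Ioc_self hp.2)]
        ring
    _ = ∫ θ in Set.Ioo (-π) π, γ θ * halfRadialMoment A θ := by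
        rw [IntegrableOn, Measure.volume_eq_prod, ← Measure.prod_restrict] at hint
        rw [Measure.volume_eq_prod, ← Measure.prod_restrict, integral_prod_symm _ hint]
        simp only [MeasureTheory.integral_const_mul, halfRadialMoment]
    _ = ∫ θ in (-π)..π, γ θ * halfRadialMoment A θ := by
        rw [intervalIntegral.integral_of_le (by linarith [Real.pi_pos]), integral_Ioc_eq_integral_Ioo]
    _ = (∫ θ in (-π)..0, γ θ * halfRadialMoment A θ)
          + ∫ θ in (0 : ℝ)..π, γ θ * halfRadialMoment A θ :=
        (intervalIntegral.integral_add_adjacent_intervals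
          (Continuous.intervalIntegrable (by fun_prop) _ _)
          (Continuous.intervalIntegrable (by fun_prop) _ _)).symm
    _ = ∫ θ in (0 : ℝ)..π, γ θ * radialMoment A 0 θ := by
        rw [hshift, ← intervalIntegral.integral_add
          (Continuous.intervalIntegrable (by fun_prop) _ _)
          (Continuous.intervalIntegrable (by fun_prop) _ _)]
        congr 1
        ext θ
        rw [radialMoment_zero_eq]
        ring

/-- The Fourier transform of the translate `f (· + x)` in the normalization of `FT`. -/
lemma exists_schwartzMap_eq_exp_mul_FT (f : SchwartzMap E2 ℂ) (x : E2) :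
    ∃ A : SchwartzMap E2 ℂ, ∀ ξ,
      A ξ = Complex.exp (Complex.I * (⟪x, ξ⟫ : ℂ)) * FT f ξ := by
  have h2pi : (2 * π)⁻¹ ≠ 0 := by positivity
  let e : E2 ≃L[ℝ] E2 := ContinuousLinearEquiv.smulLeft (Units.mk0 _ h2pi)
  refine ⟨SchwartzMap.compCLMOfContinuousLinearEquiv ℝ e
    (FourierTransform.fourier (SchwartzMap.compSubConstCLM ℝ (-x) f)), fun ξ => ?_⟩
  have he : e ξ = (2 * π)⁻¹ • ξ := rfl
  simp only [SchwartzMap.compCLMOfContinuousLinearEquiv_apply, Function.comp_apply, he,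
    SchwartzMap.fourier_coe, Real.fourier_eq', SchwartzMap.compSubConstCLM_apply, FT]
  rw [← MeasureTheory.integral_const_mul, ← integral_sub_right_eq_self _ x]
  congr 1
  ext y
  rw [sub_neg_eq_add, sub_add_cancel, smul_eq_mul, ← mul_assoc, ← Complex.exp_add]
  congr 2
  rw [inner_smul_right, inner_sub_left]
  push_cast
  have : (π : ℂ) ≠ 0 := by exact_mod_cast Real.pi_ne_zero
  field_simp
  ring

lemma norm_inv_smul_eq_omega {ξ : E2} (hξ : ξ ≠ 0) : ‖ξ‖⁻¹ • ξ = omega (toC ξ).arg := by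
  have hnorm : ‖toC ξ‖ = ‖ξ‖ := by
    rw [toC_eq_repr_symm, LinearIsometryEquiv.norm_map]
  have hne : ‖ξ‖ ≠ 0 := norm_ne_zero_iff.2 hξ
  have hξ' : ξ = ‖ξ‖ • omega (toC ξ).arg := by
    apply Complex.orthonormalBasisOneI.repr.symm.injective
    rw [← toC_eq_repr_symm, ← toC_eq_repr_symm, toC_smul_omega, ← hnorm,
      Complex.norm_mul_cos_add_sin_mul_I]
  conv_lhs => rw [hξ']
  simp [norm_smul, smul_smul, hne]

lemma integral_alias_eq {f : SchwartzMap E2 ℂ} {x : E2} {A : SchwartzMap E2 ℂ}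
    (hA : ∀ ξ, A ξ = Complex.exp (Complex.I * (⟪x, ξ⟫ : ℂ)) * FT f ξ) {ψ : E2 → ℂ}
    (hψ : Continuous fun θ => ψ (omega θ)) (hψ_even : ∀ w, ψ (-w) = ψ w) {η : ℝ → ℂ}
    (hη : Continuous η) (hper : Function.Periodic η π) :
    ∫ ξ, Complex.exp (Complex.I * (⟪x, ξ⟫ : ℂ)) * ψ (‖ξ‖⁻¹ • ξ) * η (toC ξ).arg * FT f ξ
      = ∫ θ in (0 : ℝ)..π, η θ * (ψ (omega θ) * radialMoment A 0 θ) := by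
  have key := integral_arg_mul_eq (γ := fun θ => η θ * ψ (omega θ)) (hη.mul hψ)
    (fun θ => by simp only [hper θ, omega_add_pi, hψ_even]) A
  simp only [mul_assoc] at key ⊢
  rw [← key]
  refine integral_congr_ae ?_
  filter_upwards [Measure.ae_ne volume (0 : E2)] with ξ hξ
  rw [norm_inv_smul_eq_omega hξ, hA]
  ring

lemma discreteFBP_eq {f : SchwartzMap E2 ℂ} {x : E2} {A : SchwartzMap E2 ℂ}
    (hA : ∀ ξ, A ξ = Complex.exp (Complex.I * (⟪x, ξ⟫ : ℂ)) * FT f ξ) (ψ : E2 → ℂ) (m : ℕ) :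
    discreteFBP f ψ m x = 1 / (4 * π) * ((1 / m : ℂ) * ∑ j ∈ Finset.Icc 1 m,
      ψ (omega (π * j / m)) * radialMoment A 0 (π * j / m)) := by
  have hfilt : ∀ φ, filtProj f (omega φ) ⟪x, omega φ⟫
      = 1 / (8 * (π : ℂ) ^ 2) * radialMoment A 0 φ := by
    intro φ
    rw [filtProj, radialMoment]
    congr 2
    ext q
    rw [hA, real_inner_smul_right, pow_zero, mul_one]
    push_cast
    rw [show Complex.I * (⟪x, omega φ⟫ : ℝ) * q = Complex.I * (q * (⟪x, omega φ⟫ : ℝ)) by ring]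
    ring
  have : (π : ℂ) ≠ 0 := by exact_mod_cast Real.pi_ne_zero
  simp only [discreteFBP, hfilt, Finset.mul_sum]
  refine Finset.sum_congr rfl fun j _ => ?_
  field_simp
  ring

/-- Theorem 3.2(b): aliasing expansion of the direct reconstruction,
`f_{ψ,δ} = Σ_{k∈ℤ} 𝒜_k f_ψ = f_ψ + Σ_{k≥1} G_k f_ψ`, with both series
converging absolutely. -/
theorem discreteFBP_aliasing_expansion (f : SchwartzMap E2 ℂ) (ψ : E2 → ℂ)
    (hψ_smooth : ContDiffOn ℝ (⊤ : ℕ∞) ψ {x : E2 | x ≠ 0})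
    (hψ_even : ∀ w : E2, ψ (-w) = ψ w)
    (m : ℕ) (hm : 1 ≤ m) (x : E2) :
    (Summable (fun k : ℤ => aliasTerm (⇑f) ψ m k x) ∧
      discreteFBP (⇑f) ψ m x = ∑' k : ℤ, aliasTerm (⇑f) ψ m k x) ∧
    (Summable (fun k : ℕ => cosTerm (⇑f) ψ m (k + 1) x) ∧
      discreteFBP (⇑f) ψ m x
        = aliasTerm (⇑f) ψ m 0 x + ∑' k : ℕ, cosTerm (⇑f) ψ m (k + 1) x) := by
  obtain ⟨A, hA⟩ := exists_schwartzMap_eq_exp_mul_FT f x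
  have hψ2 : ContDiff ℝ 2 fun θ => ψ (omega θ) :=
    (contDiffOn_infty.1 hψ_smooth 2).comp_contDiff contDiff_omega omega_ne_zero
  set g : ℝ → ℂ := fun θ => ψ (omega θ) * radialMoment A 0 θ with hg_def
  have hg : ContDiff ℝ 2 g := hψ2.mul (contDiff_radialMoment_nat 2 A 0)
  have hper : Function.Periodic g π := fun θ => by
    simp only [hg_def, omega_add_pi, hψ_even, radialMoment_periodic A θ]
  have halias : ∀ k : ℤ,
      aliasTerm f ψ m k x = 1 / (4 * (π : ℂ) ^ 2) * circleCoeff π g (m * k) := by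
    intro k
    have hexp : Function.Periodic
        (fun θ : ℝ => Complex.exp (-(2 * Complex.I * m * k * θ))) π := by
      intro θ
      refine Complex.exp_eq_exp_iff_exists_int.2 ⟨-(m * k), ?_⟩
      push_cast
      ring
    rw [aliasTerm, integral_alias_eq hA hψ2.continuous hψ_even (by fun_prop) hexp, circleCoeff]
    congr 2
    ext θ
    congr 2
    push_cast
    field_simp
  have hcos : ∀ k : ℕ, cosTerm f ψ m k x = aliasTerm f ψ m k x + aliasTerm f ψ m (-k) x := by
    intro k
    have hcosper : Function.Periodic
        (fun θ : ℝ => (Real.cos (2 * m * k * θ) : ℂ)) π := by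
      intro θ
      have := Real.cos_add_nat_mul_two_pi (2 * m * k * θ) (m * k)
      push_cast at this
      simp only [← this]
      congr 2
      ring
    have hgc := hg.continuous
    rw [cosTerm, integral_alias_eq hA hψ2.continuous hψ_even (by fun_prop) hcosper, halias, halias,
      ← mul_add, circleCoeff, circleCoeff, ← intervalIntegral.integral_add
        (Continuous.intervalIntegrable (by fun_prop) _ _)
        (Continuous.intervalIntegrable (by fun_prop) _ _),
      show 1 / (2 * (π : ℂ) ^ 2) = 1 / (4 * (π : ℂ) ^ 2) * 2 by field_simp; norm_num, mul_assoc,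
      ← intervalIntegral.integral_const_mul]
    congr 2
    ext θ
    rw [← add_mul, ← mul_assoc]
    congr 1
    push_cast
    rw [Complex.two_cos, add_comm]
    congr 2 <;> field_simp
  have hsum : HasSum (fun k : ℤ => aliasTerm f ψ m k x) (discreteFBP f ψ m x) := by
    rw [discreteFBP_eq hA]
    refine ((hasSum_circleCoeff_sample Real.pi_pos hg hper hm).mul_left
      (1 / (4 * π) : ℂ)).congr_fun fun k => ?_
    rw [halias]
    field_simp
  have hsum' : HasSum (fun k : ℕ => cosTerm f ψ m (k + 1) x)
      (discreteFBP f ψ m x - aliasTerm f ψ m 0 x) := by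
    have h := hsum.nat_add_neg
    simp only [← hcos] at h
    rw [← hasSum_nat_add_iff' 1, Finset.sum_range_one, hcos 0, Nat.cast_zero, neg_zero,
      add_sub_add_right_eq_sub] at h
    exact h
  exact ⟨⟨hsum.summable, hsum.tsum_eq.symm⟩, hsum'.summable, by rw [hsum'.tsum_eq]; ring⟩
end
end

section
/- Localization of the aliasing artifacts (content of Theorem 4.1 and Remark 4.2): Let R, B, s > 0 and let (f_h) be a semiclassically band limited family with data (R, B, s) as in the context. Let ψ ∈ C^∞(S¹) be even and set f_{ψ,h}(x) = (1/(4π²)) ∫_{ℝ²} e^{i x·ξ} ψ(ξ/|ξ|) 𝓕f_h(ξ) dξ. For h = π/(m s) and an integer k ≠ 0, define the k-th aliasing operator 𝓐_{k,h} g(x) = (1/(4π²)) ∫_{ℝ²} e^{i x·ξ} e^{2 i m k·arg(ξ)} 𝓕g(ξ) dξ (note 2πk/(s h) = 2mk ∈ ℤ). Then for every integer k ≠ 0, every δ > 0 and every N there is C such that |𝓐_{k,h} f_{ψ,h}(x)| ≤ C h^N for all admissible h and all x with |x| ≤ 2π|k|/(s B) − R − δ; i.e., the k-th aliasing term is negligible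 except at distance at least about 2π|k|/(s B) − R from the origin. -/
open MeasureTheory Real intervalIntegral
open scoped RealInnerProductSpace

noncomputable section

/-- A semiclassically band limited family with data `(R, B, s)`: a family
`m ↦ f_m` of Schwartz functions, `f_m` corresponding to `h = π/(m s)`, with
`supp f_h ⊆ {|x| ≤ R}`, a polynomially bounded `L²` norm `‖f_h‖_{L²} ≤ C h^{−M}`,
and, for every `B′ > B` and every `N`, `|𝓕f_h(ξ/h)| ≤ C_N h^N (1+|ξ|)^{−N}`
for `|ξ| ≥ B′`. -/
def SCBandLimited (R B s : ℝ) (f : ℕ → SchwartzMap E2 ℂ) : Prop :=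
  (∀ m : ℕ, 1 ≤ m → ∀ x : E2, R < ‖x‖ → f m x = 0) ∧
  (∃ C : ℝ, ∃ M : ℕ, ∀ m : ℕ, 1 ≤ m →
    Real.sqrt (∫ x : E2, ‖f m x‖ ^ 2) ≤ C / (π / ((m : ℝ) * s)) ^ M) ∧
  (∀ B' : ℝ, B < B' → ∀ N : ℕ, ∃ C : ℝ, ∀ m : ℕ, 1 ≤ m → ∀ ξ : E2, B' ≤ ‖ξ‖ →
    ‖FT (⇑(f m)) ((π / ((m : ℝ) * s))⁻¹ • ξ)‖
      ≤ C * (π / ((m : ℝ) * s)) ^ N / (1 + ‖ξ‖) ^ N)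

/-- The `k`-th aliasing operator applied to `f_{ψ,h}`, for `h = π/(ms)`:
`𝓐_{k,h} f_{ψ,h}(x) = (1/(4π²)) ∫ e^{i x·ξ} e^{2imk·arg ξ} 𝓕f_{ψ,h}(ξ) dξ`,
where `𝓕f_{ψ,h}(ξ) = ψ(ξ/|ξ|) 𝓕f_h(ξ)` since `f_{ψ,h}` is the Fourier
multiplier `ψ(ξ/|ξ|)` applied to `f_h`. -/
def aliasOp (f : E2 → ℂ) (ψ : E2 → ℂ) (m : ℕ) (k : ℤ) (x : E2) : ℂ :=
  (1 / (4 * (π : ℂ) ^ 2)) *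
    ∫ ξ : E2, Complex.exp (Complex.I * (⟪x, ξ⟫ : ℂ)) *
      Complex.exp (2 * Complex.I * (m : ℂ) * (k : ℂ) * ((toC ξ).arg : ℂ)) *
      (ψ (‖ξ‖⁻¹ • ξ) * FT f ξ)

/-- The point of the unit circle with polar angle `θ`. -/
def unitVec (θ : ℝ) : E2 := !₂[Real.cos θ, Real.sin θ]

/-- The derivative of `unitVec`. -/
def unitVecDeriv (θ : ℝ) : E2 := !₂[-Real.sin θ, Real.cos θ]

lemma norm_unitVec (θ : ℝ) : ‖unitVec θ‖ = 1 := by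
  simp [unitVec, EuclideanSpace.norm_eq]

lemma norm_unitVecDeriv (θ : ℝ) : ‖unitVecDeriv θ‖ = 1 := by
  simp [unitVecDeriv, EuclideanSpace.norm_eq]

lemma unitVec_add_two_pi (θ : ℝ) : unitVec (θ + 2 * π) = unitVec θ := by
  simp [unitVec]

lemma unitVecDeriv_add_two_pi (θ : ℝ) : unitVecDeriv (θ + 2 * π) = unitVecDeriv θ := by
  simp [unitVecDeriv]

lemma hasDerivAt_unitVec (θ : ℝ) : HasDerivAt unitVec (unitVecDeriv θ) θ := by
  have h : HasDerivAt (fun θ : ℝ => ![Real.cos θ, Real.sin θ]) ![-Real.sin θ, Real.cos θ] θ := by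
    refine hasDerivAt_pi.2 fun i => ?_
    fin_cases i
    · simpa using Real.hasDerivAt_cos θ
    · simpa using Real.hasDerivAt_sin θ
  exact (PiLp.hasFDerivAt_toLp (𝕜 := ℝ) 2 _).comp_hasDerivAt θ h

lemma contDiff_unitVec : ContDiff ℝ (⊤ : ℕ∞) unitVec := by
  refine contDiff_euclidean.2 fun i => ?_
  fin_cases i
  · simpa [unitVec] using Real.contDiff_cos
  · simpa [unitVec] using Real.contDiff_sin

lemma contDiff_unitVecDeriv : ContDiff ℝ (⊤ : ℕ∞) unitVecDeriv := by
  refine contDiff_euclidean.2 fun i => ?_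
  fin_cases i
  · simpa [unitVecDeriv] using Real.contDiff_sin.neg
  · simpa [unitVecDeriv] using Real.contDiff_cos

/-- The angular derivative of the phase `θ + w · unitVec θ`. -/
def phaseDeriv (p : ℝ × E2) : ℝ := 1 + ⟪p.2, unitVecDeriv p.1⟫

lemma phaseDeriv_pos {p : ℝ × E2} (hp : ‖p.2‖ < 1) : 0 < phaseDeriv p := by
  have h := abs_real_inner_le_norm p.2 (unitVecDeriv p.1)
  rw [norm_unitVecDeriv, mul_one] at h
  have := (abs_le.1 h).1
  unfold phaseDeriv
  linarith

lemma contDiff_phaseDeriv : ContDiff ℝ (⊤ : ℕ∞) phaseDeriv :=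
  contDiff_const.add (contDiff_snd.inner ℝ (contDiff_unitVecDeriv.comp contDiff_fst))

/-- The oscillating factor `e^{i n (θ + w · unitVec θ)}`. -/
def oscFactor (n : ℤ) (w : E2) (θ : ℝ) : ℂ :=
  Complex.exp (Complex.I * n * ((θ + ⟪w, unitVec θ⟫ : ℝ) : ℂ))

lemma norm_oscFactor (n : ℤ) (w : E2) (θ : ℝ) : ‖oscFactor n w θ‖ = 1 := by
  rw [oscFactor, ← Complex.norm_exp_ofReal_mul_I (n * (θ + ⟪w, unitVec θ⟫))]
  congr 2
  push_cast
  ring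

lemma oscFactor_add_two_pi (n : ℤ) (w : E2) (θ : ℝ) :
    oscFactor n w (θ + 2 * π) = oscFactor n w θ := by
  rw [oscFactor, oscFactor, unitVec_add_two_pi, Complex.exp_eq_exp_iff_exists_int]
  exact ⟨n, by push_cast; ring⟩

lemma hasDerivAt_oscFactor (n : ℤ) (w : E2) (θ : ℝ) :
    HasDerivAt (oscFactor n w) (oscFactor n w θ * (Complex.I * n * (phaseDeriv (θ, w) : ℂ))) θ := by
  have h1 : HasDerivAt (fun θ : ℝ => θ + ⟪w, unitVec θ⟫) (phaseDeriv (θ, w)) θ := by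
    have := (hasDerivAt_const θ w).inner ℝ (hasDerivAt_unitVec θ)
    exact ((hasDerivAt_id θ).add this).congr_deriv (by simp [phaseDeriv])
  exact (h1.ofReal_comp.const_mul (Complex.I * n)).cexp

/-- Nonstationary phase in the angular variable: the oscillatory integral with phase
`n (θ + w · unitVec θ)` and smooth periodic amplitude is `O(|n|^{-N})`, uniformly for
`‖w‖ ≤ c < 1`. -/
theorem exists_norm_integral_oscFactor_le {c : ℝ} (hc : c < 1) (N : ℕ) :
    ∀ a : ℝ × E2 → ℂ, (∀ p : ℝ × E2, ‖p.2‖ < 1 → ContDiffAt ℝ (⊤ : ℕ∞) a p) →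
      (∀ p, a (p + (2 * π, 0)) = a p) →
      ∃ C : ℝ, 0 ≤ C ∧ ∀ w : E2, ‖w‖ ≤ c → ∀ n : ℤ, n ≠ 0 →
        ‖∫ θ in (-π)..π, oscFactor n w θ * a (θ, w)‖ ≤ C / |(n : ℝ)| ^ N := by
  induction N with
  | zero =>
    intro a ha _
    have hcpt : IsCompact (Set.Icc (-π) π ×ˢ Metric.closedBall (0 : E2) c) :=
      isCompact_Icc.prod (isCompact_closedBall _ _)
    have hcont : ContinuousOn a (Set.Icc (-π) π ×ˢ Metric.closedBall (0 : E2) c) := by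
      intro p hp
      refine (ha p ?_).continuousAt.continuousWithinAt
      have := hp.2
      rw [mem_closedBall_zero_iff] at this
      linarith
    obtain ⟨K, hK⟩ := hcpt.exists_bound_of_continuousOn hcont
    refine ⟨max K 0 * |π - (-π)|, by positivity, fun w hw n _ => ?_⟩
    rw [pow_zero, div_one]
    refine intervalIntegral.norm_integral_le_of_norm_le_const fun θ hθ => ?_
    rw [norm_mul, norm_oscFactor, one_mul]
    rw [Set.uIoc_of_le (by linarith [Real.pi_pos])] at hθ
    exact (hK (θ, w) ⟨Set.Ioc_subset_Icc_self hθ, by simpa using hw⟩).trans (le_max_left _ _)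
  | succ N ih =>
    intro a ha hper
    set u : ℝ × E2 → ℂ := fun p => ((phaseDeriv p)⁻¹ : ℝ) • a p with hu
    have hus : ∀ p : ℝ × E2, ‖p.2‖ < 1 → ContDiffAt ℝ (⊤ : ℕ∞) u p := fun p hp =>
      (contDiff_phaseDeriv.contDiffAt.inv (phaseDeriv_pos hp).ne').smul (ha p hp)
    have huper : ∀ p, u (p + (2 * π, 0)) = u p := by
      intro p
      simp only [hu, hper]
      simp [phaseDeriv, unitVecDeriv_add_two_pi]
    obtain ⟨C, hC0, hC⟩ := ih (fun p => fderiv ℝ u p (1, 0))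
      (fun p hp => (((hus p hp).fderiv_right (m := (⊤ : ℕ∞)) (by simp)).clm_apply contDiffAt_const))
      (fun p => by
        rw [← fderiv_comp_add_right]
        simp only [huper])
    refine ⟨C, hC0, fun w hw n hn => ?_⟩
    have hw1 : ‖w‖ < 1 := by linarith
    have hnC : (n : ℂ) ≠ 0 := by exact_mod_cast hn
    have hnR : 0 < |(n : ℝ)| := by positivity
    have hline : ∀ θ : ℝ, HasDerivAt (fun θ : ℝ => u (θ, w)) (fderiv ℝ u (θ, w) (1, 0)) θ := by
      intro θ
      have h1 : HasDerivAt (fun θ : ℝ => ((θ, w) : ℝ × E2)) (1, 0) θ :=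
        (hasDerivAt_id θ).prodMk (hasDerivAt_const θ w)
      exact ((hus (θ, w) hw1).differentiableAt (by simp)).hasFDerivAt.comp_hasDerivAt θ h1
    have hpair : Continuous fun θ : ℝ => ((θ, w) : ℝ × E2) := by fun_prop
    have hosc : Continuous (oscFactor n w) :=
      continuous_iff_continuousAt.2 fun θ => (hasDerivAt_oscFactor n w θ).continuousAt
    have hca : Continuous fun θ : ℝ => a (θ, w) :=
      continuous_iff_continuousAt.2 fun θ =>
        ContinuousAt.comp (f := fun θ : ℝ => ((θ, w) : ℝ × E2)) (g := a)
          (ha (θ, w) hw1).continuousAt hpair.continuousAt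
    have hcb : Continuous fun θ : ℝ => fderiv ℝ u (θ, w) (1, 0) :=
      continuous_iff_continuousAt.2 fun θ =>
        ContinuousAt.comp (f := fun θ : ℝ => ((θ, w) : ℝ × E2))
          (g := fun p => fderiv ℝ u p (1, 0))
          (((hus (θ, w) hw1).fderiv_right (m := (⊤ : ℕ∞)) (by simp)).clm_apply
            contDiffAt_const).continuousAt hpair.continuousAt
    have hderiv : ∀ θ : ℝ, HasDerivAt (fun θ => oscFactor n w θ * u (θ, w))
        (Complex.I * n * (oscFactor n w θ * a (θ, w)) +
          oscFactor n w θ * fderiv ℝ u (θ, w) (1, 0)) θ := by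
      intro θ
      refine ((hasDerivAt_oscFactor n w θ).mul (hline θ)).congr_deriv ?_
      have hD : ((phaseDeriv (θ, w) : ℝ) : ℂ) ≠ 0 := by
        exact_mod_cast (phaseDeriv_pos (p := (θ, w)) hw1).ne'
      simp only [hu, Complex.real_smul, Complex.ofReal_inv]
      field_simp
    have hi1 : IntervalIntegrable (fun θ => Complex.I * n * (oscFactor n w θ * a (θ, w)))
        volume (-π) π := (continuous_const.mul (hosc.mul hca)).intervalIntegrable _ _
    have hi2 : IntervalIntegrable (fun θ => oscFactor n w θ * fderiv ℝ u (θ, w) (1, 0))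
        volume (-π) π := (hosc.mul hcb).intervalIntegrable _ _
    have hzero := intervalIntegral.integral_eq_sub_of_hasDerivAt (fun θ _ => hderiv θ)
      (hi1.add hi2)
    have hend : oscFactor n w π * u (π, w) = oscFactor n w (-π) * u (-π, w) := by
      have h1 := oscFactor_add_two_pi n w (-π)
      have h2 := huper (-π, w)
      have h3 : -π + 2 * π = π := by ring
      rw [h3] at h1
      simp only [Prod.mk_add_mk, h3, add_zero] at h2
      rw [h1, h2]
    rw [hend, sub_self, intervalIntegral.integral_add hi1 hi2,
      intervalIntegral.integral_const_mul] at hzero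
    have hnorm := congrArg norm (eq_neg_of_add_eq_zero_left hzero)
    rw [norm_neg, norm_mul, norm_mul, Complex.norm_I, one_mul, Complex.norm_intCast] at hnorm
    have hle := hC w hw n hn
    rw [← hnorm] at hle
    rw [pow_succ, ← div_div, le_div_iff₀ hnR, mul_comm]
    exact hle

lemma repr_polarCoord_symm (p : ℝ × ℝ) :
    Complex.orthonormalBasisOneI.repr (Complex.polarCoord.symm p) = p.1 • unitVec p.2 := by
  ext i
  fin_cases i <;> simp [unitVec, -Complex.ofReal_cos, -Complex.ofReal_sin]

lemma integral_polar (G : E2 → ℂ) :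
    ∫ ξ, G ξ = ∫ p in Set.Ioi (0 : ℝ) ×ˢ Set.Ioo (-π) π, p.1 • G (p.1 • unitVec p.2) := by
  rw [← Complex.orthonormalBasisOneI.repr.measurePreserving.integral_comp
    Complex.orthonormalBasisOneI.repr.toHomeomorph.measurableEmbedding,
    ← Complex.integral_comp_polarCoord_symm]
  simp only [repr_polarCoord_symm]
  rfl

lemma norm_setIntegral_closedBall_le {G : E2 → ℂ} {r J : ℝ} (hr : 0 ≤ r) (hJ : 0 ≤ J)
    (h : ∀ ρ : ℝ, 0 < ρ → ρ ≤ r → ‖∫ θ in (-π)..π, G (ρ • unitVec θ)‖ ≤ J) :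
    ‖∫ ξ in Metric.closedBall (0 : E2) r, G ξ‖ ≤ r * J * r := by
  set F : ℝ × ℝ → ℂ := fun p => p.1 • G (p.1 • unitVec p.2)
  have hpolar : ∫ ξ in Metric.closedBall (0 : E2) r, G ξ =
      ∫ p in Set.Ioc (0 : ℝ) r ×ˢ Set.Ioo (-π) π, F p := by
    rw [← MeasureTheory.integral_indicator Metric.isClosed_closedBall.measurableSet, integral_polar,
      ← MeasureTheory.integral_indicator (measurableSet_Ioi.prod measurableSet_Ioo),
      ← MeasureTheory.integral_indicator (measurableSet_Ioc.prod measurableSet_Ioo)]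
    congr 1
    ext p
    by_cases h0 : 0 < p.1
    · have hn : ‖p.1 • unitVec p.2‖ = p.1 := by
        rw [norm_smul, norm_unitVec, mul_one, Real.norm_of_nonneg h0.le]
      simp only [Set.indicator, Set.mem_prod, Set.mem_Ioi, Set.mem_Ioc, h0, true_and,
        mem_closedBall_zero_iff, hn, F]
      split_ifs <;> simp_all
    · simp [Set.indicator, h0]
  rw [hpolar]
  by_cases hint : IntegrableOn F (Set.Ioc (0 : ℝ) r ×ˢ Set.Ioo (-π) π) (volume.prod volume)
  · rw [Measure.volume_eq_prod, setIntegral_prod _ hint]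
    have := norm_setIntegral_le_of_norm_le_const (μ := volume) (s := Set.Ioc (0 : ℝ) r)
      (f := fun ρ => ∫ θ in Set.Ioo (-π) π, F (ρ, θ)) (C := r * J) (by simp) (fun ρ hρ => ?_)
    · simpa [hr] using this
    · simp only [F]
      rw [MeasureTheory.integral_smul, norm_smul, Real.norm_of_nonneg hρ.1.le,
        ← integral_Ioc_eq_integral_Ioo, ← intervalIntegral.integral_of_le (by linarith [Real.pi_pos])]
      exact mul_le_mul hρ.2 (h ρ hρ.1 hρ.2) (norm_nonneg _) hr
  · rw [Measure.volume_eq_prod, integral_undef hint, norm_zero]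
    positivity

/-- The full angular multiplier `e^{2imk·arg ξ} ψ(ξ/|ξ|)`. -/
def angularMultiplier (ψ : E2 → ℂ) (m : ℕ) (k : ℤ) (ξ : E2) : ℂ :=
  Complex.exp (2 * Complex.I * (m : ℂ) * (k : ℂ) * ((toC ξ).arg : ℂ)) * ψ (‖ξ‖⁻¹ • ξ)

lemma angularMultiplier_smul_unitVec (ψ : E2 → ℂ) (m : ℕ) (k : ℤ) {ρ θ : ℝ} (hρ : 0 < ρ)
    (hθ : θ ∈ Set.Ioc (-π) π) :
    angularMultiplier ψ m k (ρ • unitVec θ) =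
      Complex.exp (2 * Complex.I * (m : ℂ) * (k : ℂ) * (θ : ℂ)) * ψ (unitVec θ) := by
  have h1 : toC (ρ • unitVec θ) = (ρ : ℂ) * (Complex.cos θ + Complex.sin θ * Complex.I) := by
    simp [toC, unitVec]
    ring
  rw [angularMultiplier, h1, Complex.arg_mul_cos_add_sin_mul_I hρ hθ, norm_smul, norm_unitVec,
    mul_one, Real.norm_of_nonneg hρ.le, smul_smul, inv_mul_cancel₀ hρ.ne', one_smul]

lemma norm_angularMultiplier (ψ : E2 → ℂ) (m : ℕ) (k : ℤ) (ξ : E2) :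
    ‖angularMultiplier ψ m k ξ‖ = ‖ψ (‖ξ‖⁻¹ • ξ)‖ := by
  have : 2 * Complex.I * (m : ℂ) * (k : ℂ) * ((toC ξ).arg : ℂ) =
      ((2 * m * k * (toC ξ).arg : ℝ) : ℂ) * Complex.I := by
    push_cast
    ring
  rw [angularMultiplier, norm_mul, this, Complex.norm_exp_ofReal_mul_I, one_mul]

lemma exists_norm_comp_normalize_le {ψ : E2 → ℂ} (hψ : ContinuousOn ψ {x : E2 | x ≠ 0}) :
    ∃ K : ℝ, 0 ≤ K ∧ ∀ ξ : E2, ‖ψ (‖ξ‖⁻¹ • ξ)‖ ≤ K := by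
  obtain ⟨K, hK⟩ := (isCompact_sphere (0 : E2) 1).exists_bound_of_continuousOn
    (hψ.mono fun x hx => by
      rintro rfl
      simp at hx)
  refine ⟨max K ‖ψ 0‖, le_max_of_le_right (norm_nonneg _), fun ξ => ?_⟩
  by_cases hξ : ξ = 0
  · simp [hξ]
  · refine (hK _ ?_).trans (le_max_left _ _)
    rw [mem_sphere_zero_iff_norm, norm_smul, norm_inv, norm_norm,
      inv_mul_cancel₀ (norm_ne_zero_iff.2 hξ)]

lemma aestronglyMeasurable_angularMultiplier {ψ : E2 → ℂ}
    (hψ : ContinuousOn ψ {x : E2 | x ≠ 0}) (m : ℕ) (k : ℤ) :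
    AEStronglyMeasurable (angularMultiplier ψ m k) volume := by
  have h1 : Measurable fun ξ : E2 =>
      Complex.exp (2 * Complex.I * (m : ℂ) * (k : ℂ) * ((toC ξ).arg : ℂ)) := by
    have : Measurable toC := by
      unfold toC
      fun_prop
    fun_prop
  refine h1.aestronglyMeasurable.mul ?_
  rw [← restrict_compl_singleton (μ := (volume : Measure E2)) 0]
  refine ContinuousOn.aestronglyMeasurable ?_ (measurableSet_singleton 0).compl
  have h2 : ContinuousOn (fun ξ : E2 => ‖ξ‖⁻¹ • ξ) {0}ᶜ := by
    refine ContinuousOn.smul (continuousOn_id.norm.inv₀ fun x hx => ?_) continuousOn_id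
    exact norm_ne_zero_iff.2 hx
  exact hψ.comp h2 fun x hx => smul_ne_zero (inv_ne_zero (norm_ne_zero_iff.2 hx)) hx

lemma norm_exp_I_mul_ofReal (t : ℝ) : ‖Complex.exp (Complex.I * (t : ℂ))‖ = 1 := by
  rw [mul_comm, Complex.norm_exp_ofReal_mul_I]

/-- The kernel of the angular multiplier, cut off to the ball `‖ξ‖ ≤ r`, is `O(|mk|^{-N})` where
`‖z‖ r ≤ c · 2m|k|` with `c < 1`. -/
theorem exists_norm_kernel_le {ψ : E2 → ℂ}
    (hψ : ContDiffOn ℝ (⊤ : ℕ∞) ψ {x : E2 | x ≠ 0}) {c : ℝ} (hc : c < 1) (N : ℕ) :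
    ∃ C : ℝ, 0 ≤ C ∧ ∀ (m : ℕ) (k : ℤ) (r : ℝ) (z : E2), 1 ≤ m → k ≠ 0 → 0 ≤ r →
      r * ‖z‖ ≤ c * (2 * m * |(k : ℝ)|) →
      ‖∫ ξ in Metric.closedBall (0 : E2) r,
        Complex.exp (Complex.I * (⟪z, ξ⟫ : ℂ)) * angularMultiplier ψ m k ξ‖ ≤
        r ^ 2 * (C / (2 * m * |(k : ℝ)|) ^ N) := by
  obtain ⟨C, hC0, hC⟩ := exists_norm_integral_oscFactor_le hc N (fun p => ψ (unitVec p.1))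
    (fun p _ => by
      have hne : unitVec p.1 ≠ 0 := by
        rw [← norm_ne_zero_iff, norm_unitVec]
        exact one_ne_zero
      exact (hψ.contDiffAt (isOpen_ne.mem_nhds hne)).comp p
        (contDiff_unitVec.comp contDiff_fst).contDiffAt)
    (fun p => by simp [unitVec_add_two_pi])
  refine ⟨C, hC0, fun m k r z hm hk hr hz => ?_⟩
  have hm' : (0 : ℝ) < m := by exact_mod_cast hm
  have hk' : 0 < |(k : ℝ)| := by positivity
  have hn : (2 * m * k : ℤ) ≠ 0 := by positivity
  have habs : |((2 * m * k : ℤ) : ℝ)| = 2 * m * |(k : ℝ)| := by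
    push_cast
    rw [abs_mul, abs_of_nonneg (by positivity)]
  have hN : (0 : ℝ) < 2 * m * |(k : ℝ)| := by positivity
  have hnC : (m : ℂ) ≠ 0 ∧ (k : ℂ) ≠ 0 := ⟨by exact_mod_cast hm'.ne', by exact_mod_cast hk⟩
  have key : ∀ ρ : ℝ, 0 < ρ → ρ ≤ r → ‖∫ θ in (-π)..π,
      Complex.exp (Complex.I * (⟪z, ρ • unitVec θ⟫ : ℂ)) *
        angularMultiplier ψ m k (ρ • unitVec θ)‖ ≤ C / (2 * m * |(k : ℝ)|) ^ N := by
    intro ρ hρ hρr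
    have hw : ‖(ρ / ((2 * m * k : ℤ) : ℝ)) • z‖ ≤ c := by
      rw [norm_smul, norm_div, Real.norm_eq_abs, Real.norm_eq_abs, habs, abs_of_pos hρ,
        div_mul_eq_mul_div, div_le_iff₀ hN]
      exact (mul_le_mul_of_nonneg_right hρr (norm_nonneg z)).trans hz
    have hb := hC _ hw _ hn
    rw [habs] at hb
    convert hb using 2
    refine intervalIntegral.integral_congr_ae (ae_of_all _ fun θ hθ => ?_)
    rw [Set.uIoc_of_le (by linarith [Real.pi_pos])] at hθ
    rw [angularMultiplier_smul_unitVec ψ m k hρ hθ, ← mul_assoc, oscFactor, ← Complex.exp_add]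
    congr 2
    simp only [real_inner_smul_left, real_inner_smul_right]
    push_cast
    obtain ⟨h1, h2⟩ := hnC
    field_simp
    ring
  calc _ ≤ r * (C / (2 * m * |(k : ℝ)|) ^ N) * r :=
        norm_setIntegral_closedBall_le (G := fun ξ => Complex.exp (Complex.I * (⟪z, ξ⟫ : ℂ)) *
          angularMultiplier ψ m k ξ) hr (by positivity) key
    _ = _ := by ring

/-- The frequency-localized part of a Fourier multiplier applied to a function supported in
`‖y‖ ≤ R` is controlled by its convolution kernel. -/
theorem norm_low_freq_le {f : E2 → ℂ} (hf : Integrable f) {R : ℝ}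
    (hsupp : ∀ y, R < ‖y‖ → f y = 0) {χ : E2 → ℂ} (hχm : AEStronglyMeasurable χ volume) {K : ℝ}
    (hχ : ∀ ξ, ‖χ ξ‖ ≤ K) {r J : ℝ} {x : E2}
    (hJ : ∀ y, ‖y‖ ≤ R → ‖∫ ξ in Metric.closedBall (0 : E2) r,
      Complex.exp (Complex.I * (⟪x - y, ξ⟫ : ℂ)) * χ ξ‖ ≤ J) :
    ‖∫ ξ in Metric.closedBall (0 : E2) r,
      Complex.exp (Complex.I * (⟪x, ξ⟫ : ℂ)) * (χ ξ * FT f ξ)‖ ≤ J * ∫ y, ‖f y‖ := by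
  set μ := (volume : Measure E2).restrict (Metric.closedBall (0 : E2) r)
  have : IsFiniteMeasure μ := isFiniteMeasure_restrict.2 (measure_closedBall_lt_top.ne)
  have hswap : ∫ ξ, Complex.exp (Complex.I * (⟪x, ξ⟫ : ℂ)) * (χ ξ * FT f ξ) ∂μ =
      ∫ y, (∫ ξ, Complex.exp (Complex.I * (⟪x - y, ξ⟫ : ℂ)) * χ ξ ∂μ) * f y := by
    have hint : Integrable (Function.uncurry fun ξ y : E2 =>
        Complex.exp (Complex.I * (⟪x - y, ξ⟫ : ℂ)) * χ ξ * f y) (μ.prod volume) := by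
      refine Integrable.mono' ((hf.norm.comp_snd μ).const_mul K) ?_ (ae_of_all _ fun p => ?_)
      · refine AEStronglyMeasurable.mul (AEStronglyMeasurable.mul ?_ hχm.restrict.comp_fst)
          hf.aestronglyMeasurable.comp_snd
        exact (by fun_prop : Continuous fun p : E2 × E2 =>
          Complex.exp (Complex.I * (⟪x - p.2, p.1⟫ : ℂ))).aestronglyMeasurable
      · simp only [Function.uncurry, norm_mul, norm_exp_I_mul_ofReal, one_mul]
        exact mul_le_mul_of_nonneg_right (hχ _) (norm_nonneg _)
    simp_rw [← MeasureTheory.integral_mul_const]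
    rw [← integral_integral_swap hint]
    refine integral_congr_ae (ae_of_all _ fun ξ => ?_)
    simp only [FT]
    rw [← MeasureTheory.integral_const_mul, ← MeasureTheory.integral_const_mul]
    refine integral_congr_ae (ae_of_all _ fun y => ?_)
    have hexp : Complex.exp (Complex.I * (⟪x - y, ξ⟫ : ℂ)) =
        Complex.exp (Complex.I * (⟪x, ξ⟫ : ℂ)) * Complex.exp (-(Complex.I * (⟪y, ξ⟫ : ℂ))) := by
      rw [← Complex.exp_add, inner_sub_left]
      push_cast
      ring_nf
    simp only [hexp]
    ring
  rw [hswap, ← MeasureTheory.integral_const_mul]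
  refine norm_integral_le_of_norm_le (hf.norm.const_mul J) (ae_of_all _ fun y => ?_)
  rw [norm_mul]
  by_cases hy : ‖y‖ ≤ R
  · exact mul_le_mul_of_nonneg_right (hJ y hy) (norm_nonneg _)
  · simp [hsupp y (not_le.1 hy)]

lemma continuous_FT {f : E2 → ℂ} (hf : Integrable f) : Continuous (FT f) := by
  refine continuous_of_dominated (bound := fun y => ‖f y‖) (fun ξ => ?_)
    (fun ξ => ae_of_all _ fun y => ?_) hf.norm (ae_of_all _ fun y => ?_)
  · exact (by fun_prop : Continuous fun y : E2 =>
      Complex.exp (-(Complex.I * (⟪y, ξ⟫ : ℂ)))).aestronglyMeasurable.mul hf.aestronglyMeasurable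
  · rw [norm_mul, ← mul_neg, ← Complex.ofReal_neg, norm_exp_I_mul_ofReal, one_mul]
  · fun_prop

/-- The high-frequency part of a bounded multiplier, under cubic decay of the rescaled Fourier
transform. -/
theorem high_freq_bound {f : E2 → ℂ} (hf : Integrable f) {χ : E2 → ℂ}
    (hχm : AEStronglyMeasurable χ volume) {K : ℝ} (hχ : ∀ ξ, ‖χ ξ‖ ≤ K) {h B A : ℝ} (hh : 0 < h)
    (hA : ∀ ξ : E2, B ≤ ‖ξ‖ → ‖FT f (h⁻¹ • ξ)‖ ≤ A * (1 + ‖ξ‖) ^ (-3 : ℝ)) (x : E2) :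
    IntegrableOn (fun ξ => Complex.exp (Complex.I * (⟪x, ξ⟫ : ℂ)) * (χ ξ * FT f ξ))
        (Metric.closedBall (0 : E2) (B / h))ᶜ ∧
      ‖∫ ξ in (Metric.closedBall (0 : E2) (B / h))ᶜ,
        Complex.exp (Complex.I * (⟪x, ξ⟫ : ℂ)) * (χ ξ * FT f ξ)‖ ≤
        K * A * ((h ^ 2)⁻¹ * ∫ ξ : E2, (1 + ‖ξ‖) ^ (-3 : ℝ)) := by
  have hK : 0 ≤ K := (norm_nonneg _).trans (hχ 0)
  have hI : Integrable fun ξ : E2 => (1 + ‖ξ‖) ^ (-3 : ℝ) := by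
    refine integrable_one_add_norm ?_
    rw [finrank_euclideanSpace_fin]
    norm_num
  have hbI : Integrable fun ξ : E2 => K * A * (1 + ‖h • ξ‖) ^ (-3 : ℝ) :=
    (hI.comp_smul hh.ne').const_mul _
  have hbound : ∀ ξ ∈ (Metric.closedBall (0 : E2) (B / h))ᶜ,
      ‖Complex.exp (Complex.I * (⟪x, ξ⟫ : ℂ)) * (χ ξ * FT f ξ)‖ ≤
        K * A * (1 + ‖h • ξ‖) ^ (-3 : ℝ) := by
    intro ξ hξ
    have hξ' : B ≤ ‖h • ξ‖ := by
      rw [Set.mem_compl_iff, mem_closedBall_zero_iff, not_le, div_lt_iff₀ hh] at hξ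
      rw [norm_smul, Real.norm_of_nonneg hh.le, mul_comm]
      exact hξ.le
    have := hA _ hξ'
    rw [smul_smul, inv_mul_cancel₀ hh.ne', one_smul] at this
    rw [norm_mul, norm_exp_I_mul_ofReal, one_mul, norm_mul, mul_assoc]
    exact mul_le_mul (hχ ξ) this (norm_nonneg _) hK
  have hms : MeasurableSet (Metric.closedBall (0 : E2) (B / h))ᶜ :=
    Metric.isClosed_closedBall.measurableSet.compl
  have hae : ∀ᵐ ξ ∂(volume.restrict (Metric.closedBall (0 : E2) (B / h))ᶜ),
      ‖Complex.exp (Complex.I * (⟪x, ξ⟫ : ℂ)) * (χ ξ * FT f ξ)‖ ≤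
        K * A * (1 + ‖h • ξ‖) ^ (-3 : ℝ) := (ae_restrict_iff' hms).2 (ae_of_all _ hbound)
  refine ⟨Integrable.mono' hbI.integrableOn ?_ hae, ?_⟩
  · exact (by fun_prop : Continuous fun ξ : E2 =>
      Complex.exp (Complex.I * (⟪x, ξ⟫ : ℂ))).aestronglyMeasurable.mul
      (hχm.restrict.mul (continuous_FT hf).aestronglyMeasurable)
  · have hA0 : 0 ≤ A := by
      have hv : 0 ≤ A * (1 + ‖(EuclideanSpace.single 0 |B| : E2)‖) ^ (-3 : ℝ) :=
        (norm_nonneg _).trans (hA _ (by simpa using le_abs_self B))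
      exact nonneg_of_mul_nonneg_left hv (by positivity)
    calc _ ≤ ∫ ξ in (Metric.closedBall (0 : E2) (B / h))ᶜ,
          K * A * (1 + ‖h • ξ‖) ^ (-3 : ℝ) := norm_integral_le_of_norm_le hbI.integrableOn hae
      _ ≤ ∫ ξ : E2, K * A * (1 + ‖h • ξ‖) ^ (-3 : ℝ) :=
          setIntegral_le_integral hbI (ae_of_all _ fun ξ => by positivity)
      _ = _ := by
          rw [MeasureTheory.integral_const_mul,
            Measure.integral_comp_smul volume (fun ξ : E2 => (1 + ‖ξ‖) ^ (-3 : ℝ)) h,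
            finrank_euclideanSpace_fin, abs_of_nonneg (by positivity), smul_eq_mul]

lemma integral_norm_le_of_support {f : E2 → ℂ} (hf : Continuous f) {R : ℝ}
    (hsupp : ∀ y, R < ‖y‖ → f y = 0) :
    ∫ y, ‖f y‖ ≤ √(volume.real (Metric.closedBall (0 : E2) R)) * √(∫ y, ‖f y‖ ^ 2) := by
  set S := Metric.closedBall (0 : E2) R
  have hres : ∀ F : E2 → ℝ, (∀ y, f y = 0 → F y = 0) → ∫ y in S, F y = ∫ y, F y := by
    intro F hF
    refine setIntegral_eq_integral_of_forall_compl_eq_zero fun y hy => hF y (hsupp y ?_)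
    simpa [S] using hy
  have : IsFiniteMeasure ((volume : Measure E2).restrict S) :=
    isFiniteMeasure_restrict.2 measure_closedBall_lt_top.ne
  have hmem : MemLp (fun y => ‖f y‖) (ENNReal.ofReal 2) ((volume : Measure E2).restrict S) := by
    obtain ⟨K, hK⟩ := (isCompact_closedBall (0 : E2) R).exists_bound_of_continuousOn
      hf.norm.continuousOn
    refine MemLp.of_bound hf.norm.aestronglyMeasurable K ?_
    exact (ae_restrict_iff' Metric.isClosed_closedBall.measurableSet).2 (ae_of_all _ hK)
  have hold := integral_mul_le_Lp_mul_Lq_of_nonneg (μ := (volume : Measure E2).restrict S)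
    Real.HolderConjugate.two_two (f := fun y => ‖f y‖) (g := fun _ => (1 : ℝ))
    (ae_of_all _ fun y => norm_nonneg _) (ae_of_all _ fun y => zero_le_one) hmem (memLp_const 1)
  simp only [mul_one, Real.rpow_two, ← Real.sqrt_eq_rpow] at hold
  rw [hres _ (fun y hy => by simp [hy]), hres _ (fun y hy => by simp [hy])] at hold
  rw [mul_comm]
  simpa using hold

/-- Localization of the aliasing artifacts (Theorem 4.1 and Remark 4.2):
for `k ≠ 0` the `k`-th aliasing term `𝓐_{k,h} f_{ψ,h}` is `O(h^∞)` on the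
ball `{|x| ≤ 2π|k|/(sB) − R − δ}`. -/
theorem aliasing_artifacts_localized (R B s : ℝ) (hR : 0 < R) (hB : 0 < B) (hs : 0 < s)
    (f : ℕ → SchwartzMap E2 ℂ) (hf : SCBandLimited R B s f)
    (ψ : E2 → ℂ) (hψ_smooth : ContDiffOn ℝ (⊤ : ℕ∞) ψ {x : E2 | x ≠ 0})
    (hψ_even : ∀ w : E2, ψ (-w) = ψ w) :
    ∀ k : ℤ, k ≠ 0 → ∀ δ : ℝ, 0 < δ → ∀ N : ℕ, ∃ C : ℝ,
      ∀ m : ℕ, 1 ≤ m → ∀ x : E2, ‖x‖ ≤ 2 * π * |(k : ℝ)| / (s * B) - R - δ →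
        ‖aliasOp (⇑(f m)) ψ m k x‖ ≤ C * (π / ((m : ℝ) * s)) ^ N := by
  intro k hk δ hδ N
  obtain ⟨hsupp, ⟨C₂, M, hL2⟩, hdecay⟩ := hf
  have hk' : 0 < |(k : ℝ)| := by positivity
  set P : ℝ := 2 * π * |(k : ℝ)| / s with hP
  have hP0 : 0 < P := by positivity
  have hPB : 2 * π * |(k : ℝ)| / (s * B) = P / B := by rw [hP, div_div]
  rw [hPB]
  set B' : ℝ := B + δ * B ^ 2 / (2 * P) with hB'
  have hBB' : B < B' := by
    have : 0 < δ * B ^ 2 / (2 * P) := by positivity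
    linarith
  have hB'0 : 0 < B' := hB.trans hBB'
  set c : ℝ := B' * (P / B - δ) / P with hc
  have hc1 : c < 1 := by
    have : c = 1 - (δ * B / P / 2 + (δ * B / P) ^ 2 / 2) := by
      rw [hc, hB']
      field_simp
      ring
    rw [this]
    have : 0 < δ * B / P / 2 + (δ * B / P) ^ 2 / 2 := by positivity
    linarith
  obtain ⟨K, hK0, hK⟩ := exists_norm_comp_normalize_le hψ_smooth.continuousOn
  obtain ⟨C₁, hC₁0, hC₁⟩ := exists_norm_kernel_le hψ_smooth hc1 (N + 2 + M)
  obtain ⟨C₃, hC₃⟩ := hdecay B' hBB' (N + 3)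
  set V : ℝ := √(volume.real (Metric.closedBall (0 : E2) R))
  set I : ℝ := ∫ ξ : E2, (1 + ‖ξ‖) ^ (-3 : ℝ)
  have hI0 : 0 ≤ I := integral_nonneg fun ξ => by positivity
  set q : ℝ := ‖(1 / (4 * (π : ℂ) ^ 2))‖
  refine ⟨q * (B' ^ 2 * C₁ * V * C₂ / P ^ (N + 2 + M) + K * |C₃| * I * (π / s)),
    fun m hm x hx => ?_⟩
  have hm' : (1 : ℝ) ≤ m := by exact_mod_cast hm
  set h : ℝ := π / (m * s) with hh
  have hh0 : 0 < h := by positivity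
  have hPh : 2 * m * |(k : ℝ)| = P / h := by
    rw [hP, hh]
    field_simp
  have hhs : h ≤ π / s := by
    rw [hh]
    gcongr
    nlinarith
  have hfc : Continuous (f m) := (f m).continuous
  have hfi : Integrable (f m) := (f m).integrable
  have hχm := aestronglyMeasurable_angularMultiplier hψ_smooth.continuousOn m k
  have hχ : ∀ ξ, ‖angularMultiplier ψ m k ξ‖ ≤ K := fun ξ =>
    (norm_angularMultiplier ψ m k ξ).trans_le (hK ξ)
  set g : E2 → ℂ := fun ξ => Complex.exp (Complex.I * (⟪x, ξ⟫ : ℂ)) *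
    (angularMultiplier ψ m k ξ * FT (f m) ξ) with hg
  set S := Metric.closedBall (0 : E2) (B' / h)
  have hS : MeasurableSet S := Metric.isClosed_closedBall.measurableSet
  have hop : aliasOp (f m) ψ m k x = (1 / (4 * (π : ℂ) ^ 2)) * ∫ ξ, g ξ := by
    rw [aliasOp]
    congr 2
    ext ξ
    simp only [hg, angularMultiplier]
    ring
  have hlow : ‖∫ ξ in S, g ξ‖ ≤ B' ^ 2 * C₁ * V * C₂ / P ^ (N + 2 + M) * h ^ N := by
    have hJ := norm_low_freq_le (x := x) hfi (hsupp m hm) hχm hχ (r := B' / h)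
      (J := (B' / h) ^ 2 * (C₁ / (2 * m * |(k : ℝ)|) ^ (N + 2 + M))) fun y hy => by
        refine hC₁ m k (B' / h) (x - y) hm hk (by positivity) ?_
        have hxy : ‖x - y‖ ≤ P / B - δ := by
          have := norm_sub_le x y
          linarith
        rw [hPh]
        calc B' / h * ‖x - y‖ ≤ B' / h * (P / B - δ) := by gcongr
          _ = c * (P / h) := by
            rw [hc]
            field_simp
    have hL1 : ∫ y, ‖f m y‖ ≤ V * (C₂ / h ^ M) := (integral_norm_le_of_support hfc (hsupp m hm)).trans
      (mul_le_mul_of_nonneg_left (hL2 m hm) (Real.sqrt_nonneg _))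
    refine hJ.trans ((mul_le_mul_of_nonneg_left hL1 (by positivity)).trans_eq ?_)
    rw [hPh]
    simp only [div_pow, pow_add]
    field_simp
  obtain ⟨hhint, hhigh⟩ := high_freq_bound hfi hχm hχ hh0 (A := |C₃| * h ^ (N + 3)) (B := B')
    (fun ξ hξ => by
      refine (hC₃ m hm ξ hξ).trans ?_
      rw [Real.rpow_neg (by positivity), ← div_eq_mul_inv]
      have h1 : (1 + ‖ξ‖) ^ (3 : ℝ) ≤ (1 + ‖ξ‖) ^ (N + 3) := by
        rw [show (3 : ℝ) = ((3 : ℕ) : ℝ) by norm_num, Real.rpow_natCast]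
        exact pow_le_pow_right₀ (by linarith [norm_nonneg ξ]) (by omega)
      have h2 : C₃ ≤ |C₃| := le_abs_self _
      gcongr) x
  have hhigh' : ‖∫ ξ in Sᶜ, g ξ‖ ≤ K * |C₃| * I * (π / s) * h ^ N := by
    refine hhigh.trans ?_
    calc K * (|C₃| * h ^ (N + 3)) * ((h ^ 2)⁻¹ * I) = K * |C₃| * I * h * h ^ N := by
          field_simp
          ring
      _ ≤ _ := by gcongr
  have hlint : IntegrableOn g S := by
    refine Integrable.mono' (g := fun ξ => K * ‖FT (f m) ξ‖)
      (((continuous_FT hfi).norm.const_mul K).continuousOn.integrableOn_compact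
        (isCompact_closedBall _ _)) ?_ (ae_of_all _ fun ξ => ?_)
    · exact (by fun_prop : Continuous fun ξ : E2 =>
        Complex.exp (Complex.I * (⟪x, ξ⟫ : ℂ))).aestronglyMeasurable.mul
        (hχm.restrict.mul (continuous_FT hfi).aestronglyMeasurable)
    · simp only [hg, norm_mul, norm_exp_I_mul_ofReal, one_mul]
      exact mul_le_mul_of_nonneg_right (hχ ξ) (norm_nonneg _)
  have hgint : Integrable g := by
    rw [← integrableOn_univ, ← Set.union_compl_self S]
    exact hlint.union hhint
  rw [hop, norm_mul, ← integral_add_compl hS hgint, mul_assoc, add_mul]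
  exact mul_le_mul_of_nonneg_left ((norm_add_le _ _).trans (add_le_add hlow hhigh'))
    (norm_nonneg _)
end
end
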